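/- Theorem 1, recursive feasibility of the SL-MPSF optimisation problem: let A ∈ ℝ^{n×n}, B ∈ ℝ^{n×m}, B_w ∈ ℝ^{n×n} invertible, state constraints X = {x : ⟨A_{x,j}, x⟩ ≤ b_{x,j}, j = 1,…,n_x}, input constraints U = {u : ⟨A_{u,j}, u⟩ ≤ b_{u,j}, j = 1,…,n_u}, and a polytopic terminal set X_f = {x : ⟨A_{f,j}, x⟩ ≤ b_{f,j}, j = 1,…,n_f} together with K_f ∈ ℝ^{m×n} satisfying (A + B K_f)·X_f ⊕ B_w·B∞ⁿ ⊆ X_f, X_f ⊆ X, K_f·X_f ⊆ U. Call a state x ∈ ℝⁿ feasible if there exist Φ_x ∈ L^{N,n×n}, Φ_u ∈ L^{N,m×n}, z₀,…,z_N ∈ ℝⁿ, v₀,…,v_{N−1} ∈ ℝᵐ such that: (I − Z𝒜)Φ_x − ZℬΦ_u = ℰ; z₀ = x; z_{k+1} = A z_k + B v_k for k = 0,…,N−1; ⟨A_{x,j}, z_k⟩ + ‖(Φ_{x,w}^k)ᵀ A_{x,j}‖₁ ≤ b_{x,j} for all j and k = 0,…,N−1; ⟨A_{u,j}, v_k⟩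 + ‖(Φ_{u,w}^k)ᵀ A_{u,j}‖₁ ≤ b_{u,j} for all j and k = 0,…,N−1; and ⟨A_{f,j}, z_N⟩ + ‖(Φ_{x,w}^N)ᵀ A_{f,j}‖₁ ≤ b_{f,j} for all j. Then, if x is feasible with some feasible tuple (Φ_x, Φ_u, z, v), for every disturbance w ∈ B∞ⁿ the successor state x⁺ = A x + B v₀ + B_w w is also feasible. -/

import Mathlib

open Matrix Finset Pointwise

noncomputable section

/-- The closed unit ball of the `∞`-norm: `{w : ‖w‖∞ ≤ 1}`. -/
def Binf (ι : Type*) : Set (ι → ℝ) := {w | ∀ i, |w i| ≤ 1}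

/-- Block lower triangular: all `p × q` blocks strictly above the block diagonal vanish. -/
def BlockLT {N p q : ℕ} (M : Matrix (Fin (N+1) × Fin p) (Fin (N+1) × Fin q) ℝ) : Prop :=
  ∀ (i j : Fin (N+1)) (a : Fin p) (b : Fin q), i < j → M (i, a) (j, b) = 0

/-- Strictly block lower triangular: all blocks on or above the block diagonal vanish. -/
def StrictBlockLT {N p q : ℕ} (M : Matrix (Fin (N+1) × Fin p) (Fin (N+1) × Fin q) ℝ) : Prop :=
  ∀ (i j : Fin (N+1)) (a : Fin p) (b : Fin q), i ≤ j → M (i, a) (j, b) = 0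

/-- The block downshift operator `Z`: identity blocks on the first block subdiagonal. -/
def downshift (N n : ℕ) : Matrix (Fin (N+1) × Fin n) (Fin (N+1) × Fin n) ℝ :=
  fun p q => if ((p.1 : ℕ) = (q.1 : ℕ) + 1 ∧ p.2 = q.2) then 1 else 0

/-- `𝒜 = diag(A, …, A, 0)` with `N` copies of `A`. -/
def blkDiagA {n : ℕ} (N : ℕ) (A : Matrix (Fin n) (Fin n) ℝ) :
    Matrix (Fin (N+1) × Fin n) (Fin (N+1) × Fin n) ℝ :=
  fun p q => if (p.1 = q.1 ∧ (p.1 : ℕ) < N) then A p.2 q.2 else 0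

/-- `ℬ = diag(B, …, B, 0)` with `N` copies of `B`. -/
def blkDiagB {n m : ℕ} (N : ℕ) (B : Matrix (Fin n) (Fin m) ℝ) :
    Matrix (Fin (N+1) × Fin n) (Fin (N+1) × Fin m) ℝ :=
  fun p q => if (p.1 = q.1 ∧ (p.1 : ℕ) < N) then B p.2 q.2 else 0

/-- `ℰ = diag(I, B_w, …, B_w)` with `N` copies of `B_w`. -/
def blkDiagE {n : ℕ} (N : ℕ) (Bw : Matrix (Fin n) (Fin n) ℝ) :
    Matrix (Fin (N+1) × Fin n) (Fin (N+1) × Fin n) ℝ :=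
  fun p q => if p.1 = q.1 then
      (if (p.1 : ℕ) = 0 then (if p.2 = q.2 then (1 : ℝ) else 0) else Bw p.2 q.2) else 0

/-- The `(k, j)` block of a block matrix. -/
def blk {N p q : ℕ} (M : Matrix (Fin (N+1) × Fin p) (Fin (N+1) × Fin q) ℝ) (k j : Fin (N+1)) :
    Matrix (Fin p) (Fin q) ℝ := fun a b => M (k, a) (j, b)

/-- The last `N·n` columns of the `k`-th block row of a block matrix (the "`w`" part). -/
def blkRowW {N p n : ℕ} (M : Matrix (Fin (N+1) × Fin p) (Fin (N+1) × Fin n) ℝ) (k : Fin (N+1)) :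
    Matrix (Fin p) (Fin N × Fin n) ℝ := fun a q => M (k, a) (q.1.succ, q.2)

/-- The full `k`-th block row of a block matrix. -/
def blkRowFull {N p n : ℕ} (M : Matrix (Fin (N+1) × Fin p) (Fin (N+1) × Fin n) ℝ)
    (k : Fin (N+1)) : Matrix (Fin p) (Fin (N+1) × Fin n) ℝ := fun a q => M (k, a) q

/-- A feasible tuple for the SL-MPSF optimisation problem at state `x`. -/
def FeasTuple (n m N nx nu nf : ℕ)
    (A : Matrix (Fin n) (Fin n) ℝ) (B : Matrix (Fin n) (Fin m) ℝ)
    (Bw : Matrix (Fin n) (Fin n) ℝ)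
    (Ax : Fin nx → Fin n → ℝ) (bx : Fin nx → ℝ)
    (Au : Fin nu → Fin m → ℝ) (bu : Fin nu → ℝ)
    (Af : Fin nf → Fin n → ℝ) (bf : Fin nf → ℝ)
    (x : Fin n → ℝ)
    (Φx : Matrix (Fin (N+1) × Fin n) (Fin (N+1) × Fin n) ℝ)
    (Φu : Matrix (Fin (N+1) × Fin m) (Fin (N+1) × Fin n) ℝ)
    (z : Fin (N+1) → Fin n → ℝ) (v : Fin N → Fin m → ℝ) : Prop :=
  BlockLT Φx ∧ BlockLT Φu ∧
  ((1 - downshift N n * blkDiagA N A) * Φx - downshift N n * blkDiagB N B * Φu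
    = blkDiagE N Bw) ∧
  z 0 = x ∧
  (∀ k : Fin N, z k.succ = A *ᵥ z k.castSucc + B *ᵥ v k) ∧
  (∀ (k : Fin N) (j : Fin nx),
    Ax j ⬝ᵥ z k.castSucc + (∑ q, |((blkRowW Φx k.castSucc)ᵀ *ᵥ Ax j) q|) ≤ bx j) ∧
  (∀ (k : Fin N) (j : Fin nu),
    Au j ⬝ᵥ v k + (∑ q, |((blkRowW Φu k.castSucc)ᵀ *ᵥ Au j) q|) ≤ bu j) ∧
  (∀ j : Fin nf,
    Af j ⬝ᵥ z (Fin.last N) + (∑ q, |((blkRowW Φx (Fin.last N))ᵀ *ᵥ Af j) q|) ≤ bf j)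

/-- A state is feasible for the SL-MPSF problem if some feasible tuple exists. -/
def Feasible (n m N nx nu nf : ℕ)
    (A : Matrix (Fin n) (Fin n) ℝ) (B : Matrix (Fin n) (Fin m) ℝ)
    (Bw : Matrix (Fin n) (Fin n) ℝ)
    (Ax : Fin nx → Fin n → ℝ) (bx : Fin nx → ℝ)
    (Au : Fin nu → Fin m → ℝ) (bu : Fin nu → ℝ)
    (Af : Fin nf → Fin n → ℝ) (bf : Fin nf → ℝ)
    (x : Fin n → ℝ) : Prop :=
  ∃ (Φx : Matrix (Fin (N+1) × Fin n) (Fin (N+1) × Fin n) ℝ)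
    (Φu : Matrix (Fin (N+1) × Fin m) (Fin (N+1) × Fin n) ℝ)
    (z : Fin (N+1) → Fin n → ℝ) (v : Fin N → Fin m → ℝ),
    FeasTuple n m N nx nu nf A B Bw Ax bx Au bu Af bf x Φx Φu z v

theorem dotProduct_mulVec_eq_transpose {ι κ : Type*} [Fintype ι] [Fintype κ]
    (a : κ → ℝ) (M : Matrix κ ι ℝ) (q : ι → ℝ) : a ⬝ᵥ (M *ᵥ q) = (Mᵀ *ᵥ a) ⬝ᵥ q := by
  rw [dotProduct_mulVec, mulVec_transpose]

/-- A linear constraint tightened by a `1`-norm is the same as the constraint imposed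
robustly over the `∞`-norm ball. -/
theorem dotProduct_add_sum_abs_le_iff {ι κ : Type*} [Fintype ι] [Fintype κ]
    (a z : κ → ℝ) (M : Matrix κ ι ℝ) (b : ℝ) :
    a ⬝ᵥ z + ∑ q, |(Mᵀ *ᵥ a) q| ≤ b ↔ ∀ q ∈ Binf ι, a ⬝ᵥ (z + M *ᵥ q) ≤ b := by
  constructor
  · intro h q hq
    rw [dotProduct_add, dotProduct_mulVec_eq_transpose]
    refine le_trans (add_le_add le_rfl ?_) h
    refine Finset.sum_le_sum fun i _ => ?_
    calc (Mᵀ *ᵥ a) i * q i ≤ |(Mᵀ *ᵥ a) i * q i| := le_abs_self _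
      _ = |(Mᵀ *ᵥ a) i| * |q i| := abs_mul _ _
      _ ≤ |(Mᵀ *ᵥ a) i| := mul_le_of_le_one_right (abs_nonneg _) (hq i)
  · intro h
    have hs : (fun i => if 0 ≤ (Mᵀ *ᵥ a) i then (1 : ℝ) else -1) ∈ Binf ι := by
      intro i
      dsimp only
      split_ifs <;> simp
    have := h _ hs
    rw [dotProduct_add, dotProduct_mulVec_eq_transpose] at this
    refine le_trans (add_le_add le_rfl (le_of_eq ?_)) this
    refine Finset.sum_congr rfl fun i _ => ?_
    dsimp only
    split_ifs with h0
    · rw [abs_of_nonneg h0, mul_one]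
    · rw [abs_of_neg (not_le.mp h0), mul_neg_one]

/-- A feasible robust plan, with all data indexed by `ℕ`. The block `X k j` is the response of
the state at time `k` to the disturbance acting between times `j - 1` and `j`. -/
structure RobustPlan {n m : ℕ} (N : ℕ) (A : Matrix (Fin n) (Fin n) ℝ)
    (B : Matrix (Fin n) (Fin m) ℝ) (Bw : Matrix (Fin n) (Fin n) ℝ)
    (SX : Set (Fin n → ℝ)) (SU : Set (Fin m → ℝ)) (SF : Set (Fin n → ℝ)) (x : Fin n → ℝ)
    (X : ℕ → ℕ → Matrix (Fin n) (Fin n) ℝ) (V : ℕ → ℕ → Matrix (Fin m) (Fin n) ℝ)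
    (z : ℕ → Fin n → ℝ) (v : ℕ → Fin m → ℝ) : Prop where
  state_lower : ∀ k j, k < j → X k j = 0
  input_lower : ∀ k j, k < j → V k j = 0
  state_zero : X 0 0 = 1
  state_succ : ∀ k < N, ∀ j ≤ N, X (k + 1) j =
    A * X k j + B * V k j + if j = k + 1 then Bw else 0
  nominal_zero : z 0 = x
  nominal_succ : ∀ k < N, z (k + 1) = A *ᵥ z k + B *ᵥ v k
  state_mem : ∀ q : ℕ → Fin n → ℝ, (∀ i, q i ∈ Binf (Fin n)) → ∀ k < N,
    z k + ∑ i ∈ range k, X k (i + 1) *ᵥ q i ∈ SX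
  input_mem : ∀ q : ℕ → Fin n → ℝ, (∀ i, q i ∈ Binf (Fin n)) → ∀ k < N,
    v k + ∑ i ∈ range k, V k (i + 1) *ᵥ q i ∈ SU
  terminal_mem : ∀ q : ℕ → Fin n → ℝ, (∀ i, q i ∈ Binf (Fin n)) →
    z N + ∑ i ∈ range N, X N (i + 1) *ᵥ q i ∈ SF

theorem RobustPlan.exists_shift {n m N : ℕ} (hN : 0 < N) {A : Matrix (Fin n) (Fin n) ℝ}
    {B : Matrix (Fin n) (Fin m) ℝ} {Bw : Matrix (Fin n) (Fin n) ℝ}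
    {SX : Set (Fin n → ℝ)} {SU : Set (Fin m → ℝ)} {SF : Set (Fin n → ℝ)} {x : Fin n → ℝ}
    {X : ℕ → ℕ → Matrix (Fin n) (Fin n) ℝ} {V : ℕ → ℕ → Matrix (Fin m) (Fin n) ℝ}
    {z : ℕ → Fin n → ℝ} {v : ℕ → Fin m → ℝ}
    (h : RobustPlan N A B Bw SX SU SF x X V z v) (Kf : Matrix (Fin m) (Fin n) ℝ)
    (hinv : ∀ y ∈ SF, ∀ w ∈ Binf (Fin n), (A + B * Kf) *ᵥ y + Bw *ᵥ w ∈ SF)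
    (hX : SF ⊆ SX) (hU : ∀ y ∈ SF, Kf *ᵥ y ∈ SU)
    {w : Fin n → ℝ} (hw : w ∈ Binf (Fin n)) :
    ∃ X' V' z' v', RobustPlan N A B Bw SX SU SF (A *ᵥ x + B *ᵥ v 0 + Bw *ᵥ w) X' V' z' v' := by
  have hcons : ∀ q : ℕ → Fin n → ℝ, (∀ i, q i ∈ Binf (Fin n)) →
      ∀ i, (fun i => Nat.casesOn i w q : ℕ → Fin n → ℝ) i ∈ Binf (Fin n) := by
    rintro q hq (_ | i)
    · exact hw
    · exact hq i
  have hshift : ∀ (p : ℕ) (Y : ℕ → ℕ → Matrix (Fin p) (Fin n) ℝ) (y : Fin p → ℝ)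
      (q : ℕ → Fin n → ℝ) (k : ℕ),
      y + ∑ i ∈ range (k + 1), Y (k + 1) (i + 1) *ᵥ
        (fun i => Nat.casesOn i w q : ℕ → Fin n → ℝ) i =
      y + Y (k + 1) 1 *ᵥ w + ∑ i ∈ range k, Y (k + 1) (i + 1 + 1) *ᵥ q i := by
    intro p Y y q k
    rw [Finset.sum_range_succ', add_assoc, add_comm (Y (k + 1) 1 *ᵥ w)]
    rfl
  obtain ⟨M, rfl⟩ : ∃ M, N = M + 1 := ⟨N - 1, by omega⟩
  have hlast : ∀ q : ℕ → Fin n → ℝ, (∀ i, q i ∈ Binf (Fin n)) →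
      z (M + 1) + X (M + 1) 1 *ᵥ w + ∑ i ∈ range M, X (M + 1) (i + 1 + 1) *ᵥ q i ∈ SF := by
    intro q hq
    rw [← hshift]
    exact h.terminal_mem _ (hcons q hq)
  refine ⟨fun k j => if j = 0 then A ^ k else if k < M + 1 then X (k + 1) (j + 1) else
      (A + B * Kf) * X (M + 1) (j + 1) + if j = M + 1 then Bw else 0,
    fun k j => if j = 0 then 0 else if k < M then V (k + 1) (j + 1) else Kf * X (M + 1) (j + 1),
    fun k => if k < M + 1 then z (k + 1) + X (k + 1) 1 *ᵥ w else
      (A + B * Kf) *ᵥ (z (M + 1) + X (M + 1) 1 *ᵥ w),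
    fun k => if k < M then v (k + 1) + V (k + 1) 1 *ᵥ w else
      Kf *ᵥ (z (M + 1) + X (M + 1) 1 *ᵥ w), ?_, ?_, ?_, ?_, ?_, ?_, ?_, ?_, ?_⟩
  · intro k j hkj
    have hj : j ≠ 0 := by omega
    by_cases hk : k < M + 1
    · simp [hj, hk, h.state_lower (k + 1) (j + 1) (by omega)]
    · have : j ≠ M + 1 := by omega
      simp [hj, hk, this, h.state_lower (M + 1) (j + 1) (by omega)]
  · intro k j hkj
    have hj : j ≠ 0 := by omega
    by_cases hk : k < M
    · simp [hj, hk, h.input_lower (k + 1) (j + 1) (by omega)]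
    · simp [hj, hk, h.state_lower (M + 1) (j + 1) (by omega)]
  · simp
  · intro k hk j hjN
    rcases Nat.eq_zero_or_pos j with rfl | hj
    · simp [pow_succ']
    · have hj0 : j ≠ 0 := by omega
      by_cases hkM : k < M
      · by_cases hj' : j = M + 1
        · have hne : j ≠ k + 1 := by omega
          simp [hj0, hk, hkM, hne, h.state_lower (k + 1 + 1) (j + 1) (by omega),
            h.state_lower (k + 1) (j + 1) (by omega), h.input_lower (k + 1) (j + 1) (by omega)]
        · simp [hj0, hk, hkM, h.state_succ (k + 1) (by omega) (j + 1) (by omega)]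
      · obtain rfl : k = M := by omega
        simp [hj0, Matrix.add_mul, Matrix.mul_assoc]
  · have h11 : X 1 1 = Bw := by
      have := h.state_succ 0 (by omega) 1 (by omega)
      simpa [h.state_lower 0 1, h.input_lower 0 1] using this
    have hz := h.nominal_succ 0 (by omega)
    rw [h.nominal_zero] at hz
    simp only [zero_add] at hz
    simp [h11, hz]
  · intro k hk
    by_cases hkM : k < M
    · have h1 := h.state_succ (k + 1) (by omega) 1 (by omega)
      have h2 := h.nominal_succ (k + 1) (by omega)
      simp only [hk, hkM, h1, h2, add_lt_add_iff_right, if_true]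
      simp [Matrix.add_mulVec, Matrix.mulVec_add, Matrix.mulVec_mulVec]
      abel
    · obtain rfl : k = M := by omega
      simp [Matrix.add_mulVec, Matrix.mulVec_mulVec]
  · intro q hq k hk
    by_cases hkM : k < M
    · have := h.state_mem _ (hcons q hq) (k + 1) (by omega)
      rw [hshift] at this
      simpa [hk] using this
    · obtain rfl : k = M := by omega
      simpa using hX (hlast q hq)
  · intro q hq k hk
    by_cases hkM : k < M
    · have := h.input_mem _ (hcons q hq) (k + 1) (by omega)
      rw [hshift] at this
      simpa [hkM] using this
    · obtain rfl : k = M := by omega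
      have := hU _ (hlast q hq)
      simpa [Matrix.mulVec_add, Matrix.mulVec_sum, Matrix.mulVec_mulVec] using this
  · intro q hq
    have := hinv _ (hlast q hq) _ (hq M)
    have hsum : ∀ i ∈ range M, ((A + B * Kf) * X (M + 1) (i + 1 + 1) +
        if i + 1 = M + 1 then Bw else 0) *ᵥ q i =
        (A + B * Kf) *ᵥ (X (M + 1) (i + 1 + 1) *ᵥ q i) := by
      intro i hi
      have : i + 1 ≠ M + 1 := by have := Finset.mem_range.mp hi; omega
      rw [if_neg this, add_zero, Matrix.mulVec_mulVec]
    simp only [lt_irrefl, if_false, Nat.add_eq_zero_iff, one_ne_zero, and_false]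
    rw [Finset.sum_range_succ, Finset.sum_congr rfl hsum, ← Matrix.mulVec_sum,
      h.state_lower (M + 1) (M + 1 + 1) (by omega)]
    simpa [Matrix.mulVec_add, add_assoc] using this

theorem downshift_mul_zero {N n : ℕ} {κ : Type*}
    (Y : Matrix (Fin (N+1) × Fin n) κ ℝ) (a : Fin n) (c : κ) :
    (downshift N n * Y) (0, a) c = 0 := by
  simp [Matrix.mul_apply, downshift]

theorem downshift_mul_succ {N n : ℕ} {κ : Type*}
    (Y : Matrix (Fin (N+1) × Fin n) κ ℝ) (k : Fin N) (a : Fin n) (c : κ) :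
    (downshift N n * Y) (k.succ, a) c = Y (k.castSucc, a) c := by
  rw [Matrix.mul_apply, Finset.sum_eq_single (k.castSucc, a)]
  · simp [downshift]
  · rintro ⟨i, b⟩ - hne
    have : ¬ ((k.succ : ℕ) = (i : ℕ) + 1 ∧ a = b) := by
      rintro ⟨h1, rfl⟩
      apply hne
      rw [Prod.mk.injEq]
      refine ⟨Fin.ext ?_, rfl⟩
      simp at h1 ⊢
      omega
    simp only [downshift]
    rw [if_neg this, zero_mul]
  · simp

theorem blkDiagB_mul_castSucc {N n m p : ℕ} (B : Matrix (Fin n) (Fin m) ℝ)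
    (Y : Matrix (Fin (N+1) × Fin m) (Fin (N+1) × Fin p) ℝ) (k : Fin N) (j : Fin (N+1))
    (a : Fin n) (b : Fin p) :
    (blkDiagB N B * Y) (k.castSucc, a) (j, b) = (B * blk Y k.castSucc j) a b := by
  rw [Matrix.mul_apply, Fintype.sum_prod_type, Finset.sum_eq_single k.castSucc]
  · simp [blkDiagB, Matrix.mul_apply, blk]
  · intro i _ hne
    simp [blkDiagB, hne.symm]
  · simp

theorem blkDiagA_eq_blkDiagB {N n : ℕ} (A : Matrix (Fin n) (Fin n) ℝ) :
    blkDiagA N A = blkDiagB N A := rfl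

/-- The affine constraint of system level synthesis, written out block by block. -/
theorem system_level_iff {N n m : ℕ} (A : Matrix (Fin n) (Fin n) ℝ)
    (B : Matrix (Fin n) (Fin m) ℝ) (Bw : Matrix (Fin n) (Fin n) ℝ)
    (Φx : Matrix (Fin (N+1) × Fin n) (Fin (N+1) × Fin n) ℝ)
    (Φu : Matrix (Fin (N+1) × Fin m) (Fin (N+1) × Fin n) ℝ) :
    (1 - downshift N n * blkDiagA N A) * Φx - downshift N n * blkDiagB N B * Φu
      = blkDiagE N Bw ↔
    (∀ j, blk Φx 0 j = if j = 0 then 1 else 0) ∧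
    ∀ (k : Fin N) (j : Fin (N+1)), blk Φx k.succ j =
      A * blk Φx k.castSucc j + B * blk Φu k.castSucc j + if j = k.succ then Bw else 0 := by
  rw [Matrix.sub_mul, Matrix.one_mul, Matrix.mul_assoc, Matrix.mul_assoc, blkDiagA_eq_blkDiagB]
  constructor
  · intro h
    refine ⟨fun j => ?_, fun k j => ?_⟩
    · ext a b
      have := congrFun (congrFun h (0, a)) (j, b)
      rw [Matrix.sub_apply, Matrix.sub_apply, downshift_mul_zero, downshift_mul_zero] at this
      simp only [sub_zero] at this
      rw [blk, this]
      by_cases hj : j = 0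
      · simp [blkDiagE, hj, Matrix.one_apply]
      · simp [blkDiagE, hj, Ne.symm hj]
    · ext a b
      have := congrFun (congrFun h (k.succ, a)) (j, b)
      rw [Matrix.sub_apply, Matrix.sub_apply, downshift_mul_succ, downshift_mul_succ,
        blkDiagB_mul_castSucc, blkDiagB_mul_castSucc] at this
      rw [Matrix.add_apply, Matrix.add_apply, blk]
      by_cases hj : j = k.succ
      · simp only [blkDiagE, hj] at this ⊢
        simp at this ⊢
        linarith
      · simp only [blkDiagE, hj, Ne.symm hj] at this ⊢
        simp at this ⊢
        linarith
  · rintro ⟨h0, hs⟩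
    ext ⟨i, a⟩ ⟨j, b⟩
    rw [Matrix.sub_apply, Matrix.sub_apply]
    refine Fin.cases ?_ (fun k => ?_) i
    · have := congrFun (congrFun (h0 j) a) b
      rw [blk] at this
      rw [downshift_mul_zero, downshift_mul_zero, this]
      by_cases hj : j = 0
      · simp [blkDiagE, hj, Matrix.one_apply]
      · simp [blkDiagE, hj, Ne.symm hj]
    · have := congrFun (congrFun (hs k j) a) b
      rw [blk, Matrix.add_apply, Matrix.add_apply] at this
      rw [downshift_mul_succ, downshift_mul_succ, blkDiagB_mul_castSucc, blkDiagB_mul_castSucc,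
        this]
      by_cases hj : j = k.succ
      · simp [blkDiagE, hj]
        ring
      · simp [blkDiagE, hj, Ne.symm hj]

theorem blkRowW_mulVec {N p n : ℕ} (M : Matrix (Fin (N+1) × Fin p) (Fin (N+1) × Fin n) ℝ)
    (X : ℕ → ℕ → Matrix (Fin p) (Fin n) ℝ) (hX : ∀ k j : Fin (N+1), X k j = blk M k j)
    (hlow : ∀ k j, k < j → X k j = 0) (k : Fin (N+1)) (q : ℕ → Fin n → ℝ) :
    blkRowW M k *ᵥ (fun r => q r.1 r.2) = ∑ i ∈ range k, X k (i + 1) *ᵥ q i := by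
  have hsub : range (k : ℕ) ⊆ range N := Finset.range_subset_range.mpr (by omega)
  rw [Finset.sum_subset hsub, ← Fin.sum_univ_eq_sum_range (fun i => X k (i + 1) *ᵥ q i)]
  · ext a
    rw [Matrix.mulVec, dotProduct, Fintype.sum_prod_type, Finset.sum_apply]
    refine Finset.sum_congr rfl fun i _ => ?_
    have := hX k i.succ
    rw [Fin.val_succ] at this
    rw [this]
    rfl
  · intro i _ hi
    rw [hlow _ _ (by simp at hi; omega), Matrix.zero_mulVec]

/-- The tightened half-space constraints on a block row say that the nominal value plus any
admissible disturbance response lies in the polytope. -/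
theorem tightened_iff_robust {N p n r : ℕ}
    (M : Matrix (Fin (N+1) × Fin p) (Fin (N+1) × Fin n) ℝ)
    (X : ℕ → ℕ → Matrix (Fin p) (Fin n) ℝ) (hX : ∀ k j : Fin (N+1), X k j = blk M k j)
    (hlow : ∀ k j, k < j → X k j = 0) (k : Fin (N+1)) (y : Fin p → ℝ)
    (G : Fin r → Fin p → ℝ) (g : Fin r → ℝ) :
    (∀ j, G j ⬝ᵥ y + (∑ q, |((blkRowW M k)ᵀ *ᵥ G j) q|) ≤ g j) ↔
    ∀ q : ℕ → Fin n → ℝ, (∀ i, q i ∈ Binf (Fin n)) →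
      y + ∑ i ∈ range k, X k (i + 1) *ᵥ q i ∈ {y | ∀ j, G j ⬝ᵥ y ≤ g j} := by
  simp only [dotProduct_add_sum_abs_le_iff]
  constructor
  · intro h q hq j
    rw [← blkRowW_mulVec M X hX hlow]
    exact h j _ fun s => hq s.1 s.2
  · intro h j q hq
    have := h (fun i b => if hi : i < N then q (⟨i, hi⟩, b) else 0) (by
      intro i b
      dsimp only
      split_ifs with hi
      · exact hq _
      · simp) j
    rw [← blkRowW_mulVec M X hX hlow] at this
    simpa using this

theorem FeasTuple.exists_robustPlan {n m N nx nu nf : ℕ} (hN : 0 < N)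
    {A : Matrix (Fin n) (Fin n) ℝ} {B : Matrix (Fin n) (Fin m) ℝ}
    {Bw : Matrix (Fin n) (Fin n) ℝ}
    {Ax : Fin nx → Fin n → ℝ} {bx : Fin nx → ℝ}
    {Au : Fin nu → Fin m → ℝ} {bu : Fin nu → ℝ}
    {Af : Fin nf → Fin n → ℝ} {bf : Fin nf → ℝ} {x : Fin n → ℝ}
    {Φx : Matrix (Fin (N+1) × Fin n) (Fin (N+1) × Fin n) ℝ}
    {Φu : Matrix (Fin (N+1) × Fin m) (Fin (N+1) × Fin n) ℝ}
    {z : Fin (N+1) → Fin n → ℝ} {v : Fin N → Fin m → ℝ}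
    (h : FeasTuple n m N nx nu nf A B Bw Ax bx Au bu Af bf x Φx Φu z v) :
    ∃ X V z' v', v' 0 = v ⟨0, hN⟩ ∧ RobustPlan N A B Bw {x | ∀ j, Ax j ⬝ᵥ x ≤ bx j}
      {u | ∀ j, Au j ⬝ᵥ u ≤ bu j} {x | ∀ j, Af j ⬝ᵥ x ≤ bf j} x X V z' v' := by
  obtain ⟨hLx, hLu, hsl, hz0, hz, hcx, hcu, hcf⟩ := h
  obtain ⟨h0, hs⟩ := (system_level_iff A B Bw Φx Φu).mp hsl
  let ext : ∀ {p : ℕ}, Matrix (Fin (N+1) × Fin p) (Fin (N+1) × Fin n) ℝ →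
      ℕ → ℕ → Matrix (Fin p) (Fin n) ℝ := fun M k j =>
    if k < j then 0 else blk M (Fin.ofNat (N+1) k) (Fin.ofNat (N+1) j)
  have ext_low : ∀ {p : ℕ} (M : Matrix (Fin (N+1) × Fin p) (Fin (N+1) × Fin n) ℝ) (k j : ℕ),
      k < j → ext M k j = 0 := fun M k j hkj => if_pos hkj
  have ext_eq : ∀ {p : ℕ} (M : Matrix (Fin (N+1) × Fin p) (Fin (N+1) × Fin n) ℝ), BlockLT M →
      ∀ k j : Fin (N+1), ext M k j = blk M k j := by
    intro p M hM k j
    by_cases hkj : k < j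
    · rw [ext_low M _ _ hkj]
      ext a b
      exact (hM k j a b hkj).symm
    · simp only [ext]
      rw [if_neg (by exact hkj)]
      simp
  have hX := ext_eq Φx hLx
  have hV := ext_eq Φu hLu
  have hzk : ∀ k : Fin (N+1), z (Fin.ofNat (N+1) k) = z k := by intro k; simp
  have hvk : ∀ k : Fin N, (fun k => if hk : k < N then v ⟨k, hk⟩ else 0) (k : ℕ) = v k := by
    intro k; simp
  refine ⟨ext Φx, ext Φu, fun k => z (Fin.ofNat (N+1) k),
    fun k => if hk : k < N then v ⟨k, hk⟩ else 0, by simp [hN],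
    ext_low Φx, ext_low Φu, ?_, ?_, ?_, ?_, ?_, ?_, ?_⟩
  · have := hX 0 0
    rw [h0] at this
    simpa using this
  · intro k hk j hj
    have := hs ⟨k, hk⟩ ⟨j, by omega⟩
    rw [← hX, ← hX, ← hV] at this
    simpa [Fin.ext_iff] using this
  · rw [← hz0]
    exact hzk 0
  · intro k hk
    have h1 := hz ⟨k, hk⟩
    rw [← hzk (Fin.succ _), ← hzk (Fin.castSucc _), ← hvk] at h1
    exact h1
  · intro q hq k hk
    have := (tightened_iff_robust Φx _ hX (ext_low Φx) (Fin.castSucc ⟨k, hk⟩) _ Ax bx).mp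
      (hcx ⟨k, hk⟩) q hq
    rw [← hzk] at this
    exact this
  · intro q hq k hk
    have := (tightened_iff_robust Φu _ hV (ext_low Φu) (Fin.castSucc ⟨k, hk⟩) _ Au bu).mp
      (hcu ⟨k, hk⟩) q hq
    rw [← hvk] at this
    exact this
  · intro q hq
    have := (tightened_iff_robust Φx _ hX (ext_low Φx) (Fin.last N) _ Af bf).mp hcf q hq
    rw [← hzk] at this
    exact this

theorem RobustPlan.feasible {n m N nx nu nf : ℕ}
    {A : Matrix (Fin n) (Fin n) ℝ} {B : Matrix (Fin n) (Fin m) ℝ}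
    {Bw : Matrix (Fin n) (Fin n) ℝ}
    {Ax : Fin nx → Fin n → ℝ} {bx : Fin nx → ℝ}
    {Au : Fin nu → Fin m → ℝ} {bu : Fin nu → ℝ}
    {Af : Fin nf → Fin n → ℝ} {bf : Fin nf → ℝ} {x : Fin n → ℝ}
    {X : ℕ → ℕ → Matrix (Fin n) (Fin n) ℝ} {V : ℕ → ℕ → Matrix (Fin m) (Fin n) ℝ}
    {z : ℕ → Fin n → ℝ} {v : ℕ → Fin m → ℝ}
    (h : RobustPlan N A B Bw {x | ∀ j, Ax j ⬝ᵥ x ≤ bx j} {u | ∀ j, Au j ⬝ᵥ u ≤ bu j}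
      {x | ∀ j, Af j ⬝ᵥ x ≤ bf j} x X V z v) :
    Feasible n m N nx nu nf A B Bw Ax bx Au bu Af bf x := by
  refine ⟨Matrix.of fun r s => X r.1 s.1 r.2 s.2, Matrix.of fun r s => V r.1 s.1 r.2 s.2,
    fun k => z k, fun k => v k, ?_, ?_, ?_, h.nominal_zero, fun k => h.nominal_succ k k.isLt, ?_, ?_, ?_⟩
  · intro i j a b hij
    exact congrFun (congrFun (h.state_lower i j hij) a) b
  · intro i j a b hij
    exact congrFun (congrFun (h.input_lower i j hij) a) b
  · rw [system_level_iff]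
    refine ⟨fun j => ?_, fun k j => ?_⟩
    · change X 0 j = _
      split_ifs with hj
      · rw [hj]
        exact h.state_zero
      · exact h.state_lower _ _ (Nat.pos_of_ne_zero fun h' => hj (Fin.ext h'))
    · have := h.state_succ k k.isLt j (by omega)
      simp only [Fin.ext_iff, Fin.val_succ]
      exact this
  · intro k
    exact (tightened_iff_robust _ X (fun _ _ => rfl) h.state_lower k.castSucc _ Ax bx).mpr
      fun q hq => h.state_mem q hq k k.isLt
  · intro k
    exact (tightened_iff_robust _ V (fun _ _ => rfl) h.input_lower k.castSucc _ Au bu).mpr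
      fun q hq => h.input_mem q hq k k.isLt
  · exact (tightened_iff_robust _ X (fun _ _ => rfl) h.state_lower (Fin.last N) _ Af bf).mpr
      fun q hq => h.terminal_mem q hq

/-- Theorem 1, recursive feasibility of the SL-MPSF problem. -/
theorem stmt12 (n m N nx nu nf : ℕ) (hN : 0 < N)
    (A : Matrix (Fin n) (Fin n) ℝ) (B : Matrix (Fin n) (Fin m) ℝ)
    (Bw : Matrix (Fin n) (Fin n) ℝ) (hBw : IsUnit Bw)
    (Ax : Fin nx → Fin n → ℝ) (bx : Fin nx → ℝ)
    (Au : Fin nu → Fin m → ℝ) (bu : Fin nu → ℝ)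
    (Af : Fin nf → Fin n → ℝ) (bf : Fin nf → ℝ)
    (Kf : Matrix (Fin m) (Fin n) ℝ)
    (hinv : Matrix.mulVec (A + B * Kf) '' {x | ∀ j, Af j ⬝ᵥ x ≤ bf j}
        + Matrix.mulVec Bw '' Binf (Fin n) ⊆ {x | ∀ j, Af j ⬝ᵥ x ≤ bf j})
    (hXfX : {x : Fin n → ℝ | ∀ j, Af j ⬝ᵥ x ≤ bf j} ⊆ {x | ∀ j, Ax j ⬝ᵥ x ≤ bx j})
    (hKfU : Matrix.mulVec Kf '' {x | ∀ j, Af j ⬝ᵥ x ≤ bf j} ⊆ {u | ∀ j, Au j ⬝ᵥ u ≤ bu j})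
    (x : Fin n → ℝ)
    (Φx : Matrix (Fin (N+1) × Fin n) (Fin (N+1) × Fin n) ℝ)
    (Φu : Matrix (Fin (N+1) × Fin m) (Fin (N+1) × Fin n) ℝ)
    (z : Fin (N+1) → Fin n → ℝ) (v : Fin N → Fin m → ℝ)
    (hfeas : FeasTuple n m N nx nu nf A B Bw Ax bx Au bu Af bf x Φx Φu z v) :
    ∀ w ∈ Binf (Fin n),
      Feasible n m N nx nu nf A B Bw Ax bx Au bu Af bf
        (A *ᵥ x + B *ᵥ v ⟨0, hN⟩ + Bw *ᵥ w) := by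
  intro w hw
  obtain ⟨X, V, z', v', hv, hplan⟩ := hfeas.exists_robustPlan hN
  obtain ⟨X', V', z'', v'', hplan'⟩ := hplan.exists_shift hN Kf
    (fun y hy w hw => hinv (Set.add_mem_add (Set.mem_image_of_mem _ hy)
      (Set.mem_image_of_mem _ hw)))
    hXfX (fun y hy => hKfU (Set.mem_image_of_mem _ hy)) hw
  rw [← hv]
  exact hplan'.feasible
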